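/- For a field K of characteristic 0, a partition λ of d, and a finite-dimensional K-vector space V, the Schur functor value S^λ(V) = V^{⊗d} ⊗_{K[S_d]} S_λ (where S_λ = K[S_d]·c_λ) is zero if dim V < ℓ(λ) (the number of parts of λ), and is a nonzero irreducible representation of GL(V) if dim V ≥ ℓ(λ). -/

import Mathlib

/-!
STATEMENT 18: For K of characteristic 0, λ ⊢ d and a finite-dimensional
K-vector space V, the Schur functor value
S^λ(V) = V^{⊗d} ⊗_{K[S_d]} S_λ — realized as the image of the Young
symmetrizer c_λ acting on V^{⊗d} by permutation of tensor factors — is zero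
iff dim V < ℓ(λ), and is a nonzero irreducible representation of GL(V) when
dim V ≥ ℓ(λ).
-/

open scoped Classical TensorProduct

noncomputable section

/-- A Young tableau of shape `lam` (cells of the diagram of `lam`,
0-indexed: `(r,c)` is a cell iff `r <` number of parts `p` with `c < p`). -/
def IsYoungTableau {d : ℕ} (lam : Nat.Partition d) (T : Fin d → ℕ × ℕ) : Prop :=
  Function.Injective T ∧
    ∀ i : Fin d, (T i).1 < Multiset.countP (fun p => (T i).2 < p) lam.parts

variable (K : Type) [Field K] (V : Type) [AddCommGroup V] [Module K V]

/-- Action of a permutation on the `d`-th tensor power `V^{⊗d}`. -/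
def permAction {d : ℕ} (σ : Equiv.Perm (Fin d)) :
    (⨂[K] _ : Fin d, V) →ₗ[K] ⨂[K] _ : Fin d, V :=
  (PiTensorProduct.reindex K (fun _ : Fin d => V) σ).toLinearMap

/-- Action of the Young symmetrizer
`c_λ = (Σ_{σ ∈ R_λ} σ)(Σ_{τ ∈ C_λ} sgn(τ) τ)` of a tableau `T` on `V^{⊗d}`. -/
def youngSymmetrizerAction {d : ℕ} (T : Fin d → ℕ × ℕ) :
    (⨂[K] _ : Fin d, V) →ₗ[K] ⨂[K] _ : Fin d, V :=
  (∑ σ ∈ Finset.univ.filter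
      (fun σ : Equiv.Perm (Fin d) => ∀ i, (T (σ i)).1 = (T i).1),
        permAction K V σ) ∘ₗ
  (∑ τ ∈ Finset.univ.filter
      (fun τ : Equiv.Perm (Fin d) => ∀ i, (T (τ i)).2 = (T i).2),
        ((Equiv.Perm.sign τ : ℤ) : K) • permAction K V τ)

/-- The Schur functor value `S^λ(V) ≅ c_λ · V^{⊗d}` inside `V^{⊗d}`. -/
def schurModule {d : ℕ} (T : Fin d → ℕ × ℕ) : Submodule K (⨂[K] _ : Fin d, V) :=
  LinearMap.range (youngSymmetrizerAction K V T)

/-- The diagonal action of `g ∈ GL(V)` on `V^{⊗d}`. -/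
def glAction {d : ℕ} (g : V ≃ₗ[K] V) :
    (⨂[K] _ : Fin d, V) →ₗ[K] ⨂[K] _ : Fin d, V :=
  PiTensorProduct.map (fun _ : Fin d => (g : V →ₗ[K] V))

section combinatorics

theorem sum_countP_lt_aux (d : ℕ) (s : Multiset ℕ) (hs : ∀ p ∈ s, p ≤ d) :
    ∑ c ∈ Finset.range d, Multiset.countP (fun p => c < p) s = s.sum := by
  induction s using Multiset.induction_on with
  | empty => simp
  | cons a s ih =>
    have h1 := ih (fun p hp => hs p (Multiset.mem_cons_of_mem hp))
    have ha : a ≤ d := hs a (Multiset.mem_cons_self a s)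
    simp only [Multiset.countP_cons, Finset.sum_add_distrib, h1, Multiset.sum_cons]
    rw [add_comm]
    congr 1
    rw [← Finset.card_filter]
    have : (Finset.range d).filter (fun c => c < a) = Finset.range a := by
      ext c; simp; omega
    rw [this]; simp

theorem shape_surj {d : ℕ} {lam : Nat.Partition d} {T : Fin d → ℕ × ℕ}
    (hT : IsYoungTableau lam T) (r c : ℕ)
    (h : r < Multiset.countP (fun p => c < p) lam.parts) : ∃ i, T i = (r, c) := by
  have hle : ∀ p ∈ lam.parts, p ≤ d := fun p hp => by
    have := Multiset.single_le_sum (fun x _ => Nat.zero_le x) p hp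
    rwa [lam.parts_sum] at this
  have hc : ∀ r c, r < Multiset.countP (fun p => c < p) lam.parts → c < d := by
    intro r c h
    have : 0 < Multiset.countP (fun p => c < p) lam.parts := by omega
    obtain ⟨p, hp, hcp⟩ := Multiset.countP_pos.1 this
    exact lt_of_lt_of_le hcp (hle p hp)
  let S : Finset (Σ _ : ℕ, ℕ) := (Finset.range d).sigma
    (fun c => Finset.range (Multiset.countP (fun p => c < p) lam.parts))
  have hS : S.card = d := by
    simp only [S, Finset.card_sigma, Finset.card_range]
    rw [sum_countP_lt_aux d lam.parts hle, lam.parts_sum]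
  let f : Fin d → (Σ _ : ℕ, ℕ) := fun i => ⟨(T i).2, (T i).1⟩
  have hf : Function.Injective f := by
    intro i j hij
    apply hT.1
    simp only [f, Sigma.mk.injEq, heq_eq_eq] at hij
    exact Prod.ext hij.2 hij.1
  have himg : Finset.univ.image f = S := by
    apply Finset.eq_of_subset_of_card_le
    · intro x hx
      simp only [Finset.mem_image, Finset.mem_univ, true_and] at hx
      obtain ⟨i, rfl⟩ := hx
      simp only [S, f, Finset.mem_sigma, Finset.mem_range]
      exact ⟨hc _ _ (hT.2 i), hT.2 i⟩
    · rw [hS, Finset.card_image_of_injective _ hf]; simp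
  have hm : (⟨c, r⟩ : Σ _ : ℕ, ℕ) ∈ S := by
    simp only [S, Finset.mem_sigma, Finset.mem_range]
    exact ⟨hc _ _ h, h⟩
  rw [← himg] at hm
  simp only [Finset.mem_image, Finset.mem_univ, true_and, f, Sigma.mk.injEq, heq_eq_eq] at hm
  obtain ⟨i, h1, h2⟩ := hm
  exact ⟨i, Prod.ext h2 h1⟩

theorem shape_lower {d : ℕ} {lam : Nat.Partition d} {T : Fin d → ℕ × ℕ}
    (hT : IsYoungTableau lam T) (i : Fin d) (c : ℕ) (hc : c ≤ (T i).2) :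
    ∃ j, T j = ((T i).1, c) := by
  apply shape_surj hT
  refine lt_of_lt_of_le (hT.2 i) ?_
  simp only [Multiset.countP_eq_card_filter]
  apply Multiset.card_le_card
  exact Multiset.monotone_filter_right _ (fun p hp => by omega)

theorem shape_row_lt {d : ℕ} {lam : Nat.Partition d} {T : Fin d → ℕ × ℕ}
    (hT : IsYoungTableau lam T) (i : Fin d) : (T i).1 < lam.parts.card :=
  lt_of_lt_of_le (hT.2 i) (Multiset.countP_le_card _ _)

theorem shape_first_col {d : ℕ} {lam : Nat.Partition d} {T : Fin d → ℕ × ℕ}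
    (hT : IsYoungTableau lam T) (r : ℕ) (hr : r < lam.parts.card) : ∃ j, T j = (r, 0) := by
  apply shape_surj hT
  rwa [Multiset.countP_eq_card.2 (fun p hp => lam.parts_pos hp)]

/-- The combinatorial lemma behind von Neumann's lemma. -/
theorem comb_aux {d : ℕ} (T : Fin d → ℕ × ℕ) (hinj : Function.Injective T)
    (hlow : ∀ i c, c ≤ (T i).2 → ∃ j, T j = ((T i).1, c)) (h : Equiv.Perm (Fin d))
    (hh : ∀ i j, (T i).1 = (T j).1 → (T (h i)).2 = (T (h j)).2 → i = j) :
    ∃ s : Equiv.Perm (Fin d), ∀ i, T (s i) = ((T i).1, (T (h i)).2) := by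
  -- row lengths
  let row : ℕ → Finset (Fin d) := fun r => Finset.univ.filter (fun i => (T i).1 = r)
  let L : ℕ → ℕ := fun r => (row r).card
  have hrow : ∀ r i, i ∈ row r ↔ (T i).1 = r := by intro r i; simp [row]
  have hcolinj : ∀ r, Set.InjOn (fun i => (T i).2) (row r : Set (Fin d)) := by
    intro r i hi j hj hij
    have hi' := (hrow r i).1 hi
    have hj' := (hrow r j).1 hj
    exact hinj (Prod.ext (hi'.trans hj'.symm) hij)
  -- column below row length
  have hlt : ∀ i, (T i).2 < L (T i).1 := by
    intro i
    have hsub : Finset.range ((T i).2 + 1) ⊆ (row (T i).1).image (fun i => (T i).2) := by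
      intro c hc
      have : c ≤ (T i).2 := by simpa [Nat.lt_succ_iff] using hc
      obtain ⟨j, hj⟩ := hlow i c this
      simp only [Finset.mem_image]
      exact ⟨j, by rw [hrow, hj], by rw [hj]⟩
    have := Finset.card_le_card hsub
    rw [Finset.card_range] at this
    exact lt_of_lt_of_le (Nat.lt_of_succ_le this) Finset.card_image_le
  have hcols : ∀ r, (row r).image (fun i => (T i).2) = Finset.range (L r) := by
    intro r
    apply Finset.eq_of_subset_of_card_le
    · intro c hc
      simp only [Finset.mem_image] at hc
      obtain ⟨j, hj, rfl⟩ := hc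
      have := hlt j
      rw [(hrow r j).1 hj] at this
      simpa using this
    · rw [Finset.card_image_of_injOn (hcolinj r)]; simp [L]
  have hex : ∀ r c, c < L r → ∃ j, T j = (r, c) := by
    intro r c hc
    have : c ∈ (row r).image (fun i => (T i).2) := by rw [hcols]; simpa using hc
    simp only [Finset.mem_image] at this
    obtain ⟨j, hj, hjc⟩ := this
    exact ⟨j, Prod.ext ((hrow r j).1 hj) hjc⟩
  have hmin : ∀ r m, ((row r).filter (fun i => (T i).2 < m)).card = min (L r) m := by
    intro r m
    have h1 : ((row r).filter (fun i => (T i).2 < m)).image (fun i => (T i).2)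
        = Finset.range (min (L r) m) := by
      have h2 := hcols r
      ext c
      rw [Finset.mem_range, lt_min_iff, ← Finset.mem_range, ← h2]
      simp only [Finset.mem_image, Finset.mem_filter]
      constructor
      · rintro ⟨i, ⟨hi, him⟩, rfl⟩
        exact ⟨⟨i, hi, rfl⟩, him⟩
      · rintro ⟨⟨i, hi, rfl⟩, him⟩
        exact ⟨i, ⟨hi, him⟩, rfl⟩
    rw [← Finset.card_range (min (L r) m), ← h1, Finset.card_image_of_injOn]
    exact (hcolinj r).mono (by intro x hx; simp at hx ⊢; exact hx.1)
  have hle : ∀ r m, ((row r).filter (fun i => (T (h i)).2 < m)).card ≤ min (L r) m := by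
    intro r m
    apply le_min
    · exact Finset.card_le_card (Finset.filter_subset _ _)
    · rw [← Finset.card_range m]
      apply Finset.card_le_card_of_injOn (fun i => (T (h i)).2)
      · intro i hi
        simp at hi ⊢; exact hi.2
      · intro i hi j hj hij
        simp only [Finset.coe_filter, Set.mem_ofPred_eq, hrow] at hi hj
        exact hh i j (hi.1.trans hj.1.symm) hij
  obtain ⟨N, hN⟩ : ∃ N, ∀ i, (T i).1 < N := by
    refine ⟨(Finset.univ.sup fun i => (T i).1) + 1, fun i => Nat.lt_succ_of_le ?_⟩
    exact Finset.le_sup (f := fun i => (T i).1) (Finset.mem_univ i)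
  have htot : ∀ (P : Fin d → Prop), ∑ r ∈ Finset.range N, ((row r).filter P).card
      = (Finset.univ.filter P).card := by
    intro P
    rw [Finset.card_eq_sum_card_fiberwise (f := fun i => (T i).1) (t := Finset.range N)]
    · apply Finset.sum_congr rfl
      intro r _
      congr 1
      ext i; simp [row, and_comm]
    · intro i _; simpa using hN i
  have heq : ∀ m, ∀ r ∈ Finset.range N,
      ((row r).filter (fun i => (T (h i)).2 < m)).card = min (L r) m := by
    intro m
    apply (Finset.sum_eq_sum_iff_of_le (fun r _ => hle r m)).1
    rw [← Finset.sum_congr rfl (fun r _ => hmin r m)]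
    refine (Eq.trans ?_ (htot (fun i => (T (h i)).2 < m))).trans
      (Eq.trans ?_ (Eq.trans (htot (fun i => (T i).2 < m)).symm ?_))
    · apply Finset.sum_congr rfl; intro r _; congr
    rotate_left
    · apply Finset.sum_congr rfl; intro r _; congr
    apply Finset.card_bij (fun i _ => h i)
    · intro i hi; simpa using hi
    · intro i _ j _ hij; exact h.injective hij
    · intro j hj; exact ⟨h.symm j, by simpa using hj, by simp⟩
  have hkey : ∀ i, (T (h i)).2 < L (T i).1 := by
    intro i
    have h1 := heq (L (T i).1) (T i).1 (by simpa using hN i)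
    rw [min_self] at h1
    have h2 := Finset.eq_of_subset_of_card_le (Finset.filter_subset _ _) h1.ge
    have h3 : i ∈ row (T i).1 := (hrow _ _).2 rfl
    rw [← h2] at h3
    exact (Finset.mem_filter.1 h3).2
  choose s hs using fun i => hex (T i).1 (T (h i)).2 (hkey i)
  have hsinj : Function.Injective s := by
    intro i j hij
    have h1 := hs i
    rw [hij, hs j] at h1
    simp only [Prod.mk.injEq] at h1
    exact hh i j h1.1.symm h1.2.symm
  exact ⟨Equiv.ofBijective s (Finite.injective_iff_bijective.1 hsinj), fun i => hs i⟩

end combinatorics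

section groupAlgebra

theorem row_inv {d : ℕ} {T : Fin d → ℕ × ℕ} {p : Equiv.Perm (Fin d)}
    (hp : ∀ i, (T (p i)).1 = (T i).1) : ∀ i, (T (p⁻¹ i)).1 = (T i).1 := by
  intro i
  have := hp (p⁻¹ i)
  rw [← this]; simp

theorem col_inv {d : ℕ} {T : Fin d → ℕ × ℕ} {p : Equiv.Perm (Fin d)}
    (hp : ∀ i, (T (p i)).2 = (T i).2) : ∀ i, (T (p⁻¹ i)).2 = (T i).2 := by
  intro i
  have := hp (p⁻¹ i)
  rw [← this]; simp

/-- Each permutation is in `R_λ C_λ`, or is fixed by an odd pair in `R_λ × C_λ`. -/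
theorem dichotomy {d : ℕ} {T : Fin d → ℕ × ℕ} (hinj : Function.Injective T)
    (hlow : ∀ i c, c ≤ (T i).2 → ∃ j, T j = ((T i).1, c)) (g : Equiv.Perm (Fin d)) :
    (∃ p q : Equiv.Perm (Fin d), (∀ i, (T (p i)).1 = (T i).1) ∧
      (∀ i, (T (q i)).2 = (T i).2) ∧ g = p * q) ∨
    (∃ p q : Equiv.Perm (Fin d), (∀ i, (T (p i)).1 = (T i).1) ∧
      (∀ i, (T (q i)).2 = (T i).2) ∧ p * (g * q) = g ∧ Equiv.Perm.sign q = -1) := by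
  by_cases hh : ∀ i j, (T i).1 = (T j).1 → (T (g⁻¹ i)).2 = (T (g⁻¹ j)).2 → i = j
  · left
    obtain ⟨s, hs⟩ := comb_aux T hinj hlow g⁻¹ hh
    refine ⟨s⁻¹, s * g, row_inv (fun i => by rw [hs]), fun i => ?_, by group⟩
    rw [Equiv.Perm.mul_apply, hs]; simp
  · right
    push Not at hh
    obtain ⟨i, j, h1, h2, h3⟩ := hh
    refine ⟨Equiv.swap i j, Equiv.swap (g⁻¹ i) (g⁻¹ j), ?_, ?_, ?_, ?_⟩
    · intro k
      rw [Equiv.swap_apply_def]; split_ifs with h h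
      · rw [h, h1]
      · rw [h, h1]
      · rfl
    · intro k
      rw [Equiv.swap_apply_def]; split_ifs with h h
      · rw [h, h2]
      · rw [h, h2]
      · rfl
    · rw [Equiv.mul_swap_eq_swap_mul]
      simp [← mul_assoc]
    · exact Equiv.Perm.sign_swap (fun h => h3 (g⁻¹.injective h))

variable {d : ℕ}

/-- row symmetrizer in the group algebra -/
def rowSym (T : Fin d → ℕ × ℕ) : MonoidAlgebra K (Equiv.Perm (Fin d)) :=
  ∑ σ ∈ Finset.univ.filter
      (fun σ : Equiv.Perm (Fin d) => ∀ i, (T (σ i)).1 = (T i).1), MonoidAlgebra.single σ 1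

/-- column antisymmetrizer in the group algebra -/
def colSym (T : Fin d → ℕ × ℕ) : MonoidAlgebra K (Equiv.Perm (Fin d)) :=
  ∑ τ ∈ Finset.univ.filter
      (fun τ : Equiv.Perm (Fin d) => ∀ i, (T (τ i)).2 = (T i).2),
        MonoidAlgebra.single τ ((Equiv.Perm.sign τ : ℤ) : K)

theorem single_mul_rowSym {T : Fin d → ℕ × ℕ} {p : Equiv.Perm (Fin d)}
    (hp : ∀ i, (T (p i)).1 = (T i).1) :
    MonoidAlgebra.single p 1 * rowSym K T = rowSym K T := by
  unfold rowSym
  rw [Finset.mul_sum]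
  apply Finset.sum_equiv (Equiv.mulLeft p)
  · intro σ
    simp [hp]
  · intro σ _
    simp

theorem colSym_mul_single {T : Fin d → ℕ × ℕ} {q : Equiv.Perm (Fin d)}
    (hq : ∀ i, (T (q i)).2 = (T i).2) :
    colSym K T * MonoidAlgebra.single q 1 = ((Equiv.Perm.sign q : ℤ) : K) • colSym K T := by
  unfold colSym
  rw [Finset.sum_mul, Finset.smul_sum]
  apply Finset.sum_equiv (Equiv.mulRight q)
  · intro σ
    simp only [Finset.mem_filter, Finset.mem_univ, true_and, Equiv.coe_mulRight,
      Equiv.Perm.mul_apply]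
    constructor
    · intro h i; rw [h, hq]
    · intro h i
      have := h (q⁻¹ i)
      rw [col_inv hq] at this
      simpa using this
  · intro σ _
    have h1 : ((Equiv.Perm.sign q : ℤ) : K) * ((Equiv.Perm.sign q : ℤ) : K) = 1 := by
      rcases Int.units_eq_one_or (Equiv.Perm.sign q) with h | h <;> simp [h]
    simp only [MonoidAlgebra.single_mul_single, Equiv.coe_mulRight, map_mul, Units.val_mul,
      Int.cast_mul, MonoidAlgebra.smul_single, smul_eq_mul, mul_one]
    congr 1
    linear_combination (-((Equiv.Perm.sign σ : ℤ) : K)) * h1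

theorem coeff_sandwich_row {T : Fin d → ℕ × ℕ} (x : MonoidAlgebra K (Equiv.Perm (Fin d)))
    {p : Equiv.Perm (Fin d)} (hp : ∀ i, (T (p i)).1 = (T i).1) (g : Equiv.Perm (Fin d)) :
    (rowSym K T * x * colSym K T).coeff (p * g) = (rowSym K T * x * colSym K T).coeff g := by
  conv_lhs => rw [← single_mul_rowSym K hp]
  rw [mul_assoc, mul_assoc, MonoidAlgebra.coeff_single_mul_mul, one_mul, ← mul_assoc]

theorem coeff_sandwich_col {T : Fin d → ℕ × ℕ} (x : MonoidAlgebra K (Equiv.Perm (Fin d)))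
    {q : Equiv.Perm (Fin d)} (hq : ∀ i, (T (q i)).2 = (T i).2) (g : Equiv.Perm (Fin d)) :
    (rowSym K T * x * colSym K T).coeff (g * q) =
      ((Equiv.Perm.sign q : ℤ) : K) * (rowSym K T * x * colSym K T).coeff g := by
  have h1 : ((Equiv.Perm.sign q : ℤ) : K) * ((Equiv.Perm.sign q : ℤ) : K) = 1 := by
    rcases Int.units_eq_one_or (Equiv.Perm.sign q) with h | h <;> simp [h]
  have h2 := MonoidAlgebra.coeff_mul_single_mul (rowSym K T * x * colSym K T) 1 q g
  rw [mul_assoc, colSym_mul_single K hq, mul_smul_comm, MonoidAlgebra.coeff_smul_apply, mul_one,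
    smul_eq_mul] at h2
  rw [← h2, ← mul_assoc, h1, one_mul]

/-- von Neumann's lemma -/
theorem vonNeumann [CharZero K] {T : Fin d → ℕ × ℕ} (hinj : Function.Injective T)
    (hlow : ∀ i c, c ≤ (T i).2 → ∃ j, T j = ((T i).1, c))
    (x y : MonoidAlgebra K (Equiv.Perm (Fin d))) :
    (rowSym K T * y * colSym K T).coeff 1 • (rowSym K T * x * colSym K T) =
    (rowSym K T * x * colSym K T).coeff 1 • (rowSym K T * y * colSym K T) := by
  ext g
  rw [MonoidAlgebra.coeff_smul_apply, MonoidAlgebra.coeff_smul_apply]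
  rcases dichotomy hinj hlow g with ⟨p, q, hp, hq, rfl⟩ | ⟨p, q, hp, hq, hg, hs⟩
  · have h : ∀ z, (rowSym K T * z * colSym K T).coeff (p * q) =
        ((Equiv.Perm.sign q : ℤ) : K) * (rowSym K T * z * colSym K T).coeff 1 := by
      intro z
      rw [coeff_sandwich_row K z hp, ← coeff_sandwich_col K z hq, one_mul]
    rw [h, h]; simp only [smul_eq_mul]; ring
  · have h : ∀ z, (rowSym K T * z * colSym K T).coeff g = 0 := by
      intro z
      have := coeff_sandwich_row K z hp (g * q)
      rw [hg, coeff_sandwich_col K z hq, hs] at this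
      simp at this
      exact self_eq_neg.1 this
    rw [h, h]; simp

/-- the Young symmetrizer -/
def youngSym (T : Fin d → ℕ × ℕ) : MonoidAlgebra K (Equiv.Perm (Fin d)) :=
  rowSym K T * colSym K T

theorem perm_eq_one_of_row_col {T : Fin d → ℕ × ℕ} (hinj : Function.Injective T)
    {σ : Equiv.Perm (Fin d)} (h1 : ∀ i, (T (σ i)).1 = (T i).1)
    (h2 : ∀ i, (T (σ i)).2 = (T i).2) : σ = 1 := by
  ext i
  rw [hinj (Prod.ext (h1 i) (h2 i))]; simp

theorem colSym_coeff (T : Fin d → ℕ × ℕ) (g : Equiv.Perm (Fin d)) :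
    (colSym K T).coeff g = if (∀ i, (T (g i)).2 = (T i).2) then
      ((Equiv.Perm.sign g : ℤ) : K) else 0 := by
  unfold colSym
  simp [Finsupp.single_apply, Finset.sum_ite_eq', MonoidAlgebra.coeff_sum, Finsupp.finsetSum_apply]

theorem youngSym_coeff_one {T : Fin d → ℕ × ℕ} (hinj : Function.Injective T) :
    (youngSym K T).coeff 1 = 1 := by
  unfold youngSym
  rw [rowSym, Finset.sum_mul]
  simp only [MonoidAlgebra.coeff_sum, Finsupp.finsetSum_apply,
    MonoidAlgebra.coeff_single_mul_apply, mul_one, one_mul, colSym_coeff]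
  rw [Finset.sum_eq_single 1]
  · simp
  · intro σ hσ hne
    rw [if_neg]
    intro h
    have h' := col_inv h
    rw [inv_inv] at h'
    exact hne (perm_eq_one_of_row_col hinj (by simpa using hσ) h')
  · intro h; simp at h

theorem coeff_one_comm (x y : MonoidAlgebra K (Equiv.Perm (Fin d))) :
    (x * y).coeff 1 = (y * x).coeff 1 := by
  induction y using MonoidAlgebra.induction_linear with
  | zero => simp
  | add f g hf hg => simp [mul_add, add_mul, hf, hg]
  | single g r => simp [mul_comm]

theorem youngSym_sandwich [CharZero K] {T : Fin d → ℕ × ℕ} (hinj : Function.Injective T)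
    (hlow : ∀ i c, c ≤ (T i).2 → ∃ j, T j = ((T i).1, c))
    (x : MonoidAlgebra K (Equiv.Perm (Fin d))) :
    youngSym K T * x * youngSym K T =
      (youngSym K T * youngSym K T * x).coeff 1 • youngSym K T := by
  have h := vonNeumann K hinj hlow (colSym K T * x * rowSym K T) 1
  have e1 : rowSym K T * 1 * colSym K T = youngSym K T := by simp [youngSym]
  have e2 : rowSym K T * (colSym K T * x * rowSym K T) * colSym K T =
    youngSym K T * x * youngSym K T := by simp only [youngSym, mul_assoc]
  rw [e1, e2, youngSym_coeff_one K hinj, one_smul] at h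
  rw [h, coeff_one_comm K (youngSym K T * x) (youngSym K T), ← mul_assoc]

theorem youngSym_sq [CharZero K] {T : Fin d → ℕ × ℕ} (hinj : Function.Injective T)
    (hlow : ∀ i c, c ≤ (T i).2 → ∃ j, T j = ((T i).1, c)) :
    ∃ n : K, n ≠ 0 ∧ youngSym K T * youngSym K T = n • youngSym K T := by
  have h := youngSym_sandwich K hinj hlow 1
  rw [mul_one, mul_one] at h
  refine ⟨_, fun h0 => ?_, h⟩
  rw [h0, zero_smul] at h
  have hnil : IsNilpotent (LinearMap.mulLeft K (youngSym K T)) := by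
    refine ⟨2, ?_⟩
    refine LinearMap.ext fun x => ?_
    rw [pow_two, Module.End.mul_apply]
    simp [← mul_assoc, h]
  have htr := (LinearMap.isNilpotent_trace_of_isNilpotent hnil).eq_zero
  rw [LinearMap.trace_eq_matrix_trace K (MonoidAlgebra.basis (Equiv.Perm (Fin d)) K),
    Matrix.trace] at htr
  have : ∀ g : Equiv.Perm (Fin d), (LinearMap.toMatrix (MonoidAlgebra.basis (Equiv.Perm (Fin d)) K)
      (MonoidAlgebra.basis (Equiv.Perm (Fin d)) K)
      (LinearMap.mulLeft K (youngSym K T))).diag g = 1 := by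
    intro g
    rw [Matrix.diag_apply, LinearMap.toMatrix_apply, MonoidAlgebra.basis_apply]
    change ((youngSym K T) * MonoidAlgebra.single g 1).coeff g = 1
    rw [MonoidAlgebra.coeff_mul_single_apply, mul_inv_cancel, youngSym_coeff_one K hinj, one_mul]
  rw [Finset.sum_congr rfl (fun g _ => this g)] at htr
  simp [Fintype.card_perm, Nat.factorial_ne_zero] at htr

end groupAlgebra

section polarization

/-- Polarization: a multilinear map vanishing on the diagonal has vanishing symmetrization. -/
theorem polarization {E Q : Type} [AddCommGroup E] [Module K E] [AddCommGroup Q] [Module K Q]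
    {d : ℕ} (F : MultilinearMap K (fun _ : Fin d => E) Q) (hF : ∀ B : E, F (fun _ => B) = 0)
    (A : Fin d → E) : ∑ σ : Equiv.Perm (Fin d), F (fun i => A (σ i)) = 0 := by
  have h0 : ∀ S : Finset (Fin d), ∑ r : Fin d → Fin d,
      (∏ i, (if r i ∈ S then (1 : K) else 0)) • F (fun i => A (r i)) = 0 := by
    intro S
    rw [← hF (∑ j, (if j ∈ S then (1 : K) else 0) • A j), MultilinearMap.map_sum]
    apply Finset.sum_congr rfl
    intro r _
    rw [← MultilinearMap.map_smul_univ]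
  have h1 : ∑ r : Fin d → Fin d, (∑ S : Finset (Fin d), (-1 : K) ^ S.card *
      (∏ i, (if r i ∈ S then (1 : K) else 0))) • F (fun i => A (r i)) = 0 := by
    simp only [Finset.sum_smul]
    rw [Finset.sum_comm]
    apply Finset.sum_eq_zero
    intro S _
    simp only [mul_smul]
    rw [← Finset.smul_sum, h0, smul_zero]
  have h2 : ∀ r : Fin d → Fin d, (∑ S : Finset (Fin d), (-1 : K) ^ S.card *
      (∏ i, (if r i ∈ S then (1 : K) else 0))) =
      ∏ j : Fin d, ((-1 : K) + if (∃ i, r i = j) then 0 else 1) := by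
    intro r
    rw [Finset.prod_add, Finset.powerset_univ]
    apply Finset.sum_congr rfl
    intro S _
    rw [Finset.prod_const]
    congr 1
    rw [Finset.prod_ite_zero, Finset.prod_const_one]
    have : (∏ j ∈ Finset.univ \ S, if (∃ i, r i = j) then (0 : K) else 1) =
        ∏ j ∈ Finset.univ \ S, if ¬ (∃ i, r i = j) then (1 : K) else 0 := by
      apply Finset.prod_congr rfl; intro j _; split_ifs <;> simp_all
    rw [this, Finset.prod_ite_zero, Finset.prod_const_one]
    have hiff : (∀ i ∈ Finset.univ, r i ∈ S) ↔ ∀ j ∈ Finset.univ \ S, ¬ ∃ i, r i = j := by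
      simp only [Finset.mem_univ, true_implies, Finset.mem_sdiff, true_and]
      constructor
      · rintro h j hj ⟨i, rfl⟩; exact hj (h i)
      · intro h i; by_contra hi; exact h _ hi ⟨i, rfl⟩
    by_cases hc : ∀ i ∈ Finset.univ, r i ∈ S
    · rw [if_pos hc, if_pos (hiff.1 hc)]
    · rw [if_neg hc, if_neg (fun h => hc (hiff.2 h))]
  have h3 : ∀ r : Fin d → Fin d,
      (∏ j : Fin d, ((-1 : K) + if (∃ i, r i = j) then 0 else 1)) =
      if Function.Bijective r then (-1) ^ d else 0 := by
    intro r
    split_ifs with hr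
    · rw [Finset.prod_congr rfl (g := fun _ => (-1 : K))]
      · simp
      · intro j _
        rw [if_pos (hr.2 j), add_zero]
    · rw [← Finite.surjective_iff_bijective] at hr
      unfold Function.Surjective at hr
      push Not at hr
      obtain ⟨j, hj⟩ := hr
      apply Finset.prod_eq_zero (Finset.mem_univ j)
      rw [if_neg (by push Not; exact hj)]; simp
  simp only [h2, h3, ite_smul, zero_smul] at h1
  rw [← Finset.sum_filter, ← Finset.smul_sum] at h1
  have h4 := (smul_eq_zero.1 h1).resolve_left (pow_ne_zero _ (by simp))
  rw [← h4]
  apply Finset.sum_bij (fun (σ : Equiv.Perm (Fin d)) _ => (σ : Fin d → Fin d))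
  · intro σ _; exact Finset.mem_filter.2 ⟨Finset.mem_univ _, σ.bijective⟩
  · intro σ _ τ _ h; exact DFunLike.coe_injective h
  · intro r hr
    exact ⟨Equiv.ofBijective r (Finset.mem_filter.1 hr).2, Finset.mem_univ _, rfl⟩
  · intro σ _; rfl

/-- Density of the invertible operators. -/
theorem diag_of_gl [CharZero K] [FiniteDimensional K V]
    {Q : Type} [AddCommGroup Q] [Module K Q] {d : ℕ}
    (F : MultilinearMap K (fun _ : Fin d => (V →ₗ[K] V)) Q)
    (hF : ∀ g : V ≃ₗ[K] V, F (fun _ => (g : V →ₗ[K] V)) = 0) (B : V →ₗ[K] V) :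
    F (fun _ => B) = 0 := by
  rw [← Module.forall_dual_apply_eq_zero_iff K]
  intro ψ
  let p : Polynomial K := ∑ S : Finset (Fin d),
    Polynomial.C (ψ (F (S.piecewise (fun _ => B) (fun _ => 1)))) *
      Polynomial.X ^ (Finset.univ \ S).card
  have hp : ∀ t : K, p.eval t = ψ (F (fun _ => B + t • 1)) := by
    intro t
    have : (fun _ : Fin d => B + t • (1 : V →ₗ[K] V)) = (fun _ => B) + (fun _ => t • 1) := rfl
    rw [this, MultilinearMap.map_add_univ, map_sum]
    simp only [p, Polynomial.eval_finsetSum, Polynomial.eval_mul, Polynomial.eval_C,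
      Polynomial.eval_pow, Polynomial.eval_X]
    apply Finset.sum_congr rfl
    intro S _
    have h1 : S.piecewise (fun _ : Fin d => B) (fun _ => t • (1 : V →ₗ[K] V)) =
        fun i => (if i ∈ S then (1 : K) else t) •
          (S.piecewise (fun _ : Fin d => B) (fun _ => (1 : V →ₗ[K] V))) i := by
      funext i
      by_cases hi : i ∈ S <;> simp [hi]
    rw [h1, MultilinearMap.map_smul_univ, map_smul, smul_eq_mul, mul_comm]
    congr 1
    rw [Finset.prod_ite, Finset.prod_const_one, one_mul, Finset.prod_const]
    congr 2
    ext i; simp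
  have hp0 : p = 0 := by
    apply Polynomial.eq_zero_of_infinite_isRoot
    have hfin : (spectrum K (-B : Module.End K V)).Finite := Module.End.finite_spectrum _
    refine hfin.infinite_compl.mono ?_
    intro t ht
    have hu : IsUnit (B + t • (1 : Module.End K V)) := by
      have := spectrum.notMem_iff.1 ht
      rwa [sub_neg_eq_add, Algebra.algebraMap_eq_smul_one, add_comm] at this
    change p.eval t = 0
    rw [hp]
    have hb := (Module.End.isUnit_iff _).1 hu
    have := hF (LinearEquiv.ofBijective (B + t • (1 : V →ₗ[K] V)) hb)
    have h2 : ((LinearEquiv.ofBijective (B + t • (1 : V →ₗ[K] V)) hb : V ≃ₗ[K] V) : V →ₗ[K] V)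
      = B + t • 1 := by ext; rfl
    rw [h2] at this
    rw [this, map_zero]
  have := hp 0
  rw [hp0] at this
  simpa using this.symm

end polarization

section representation

variable {d : ℕ}

theorem permAction_tprod (σ : Equiv.Perm (Fin d)) (f : Fin d → V) :
    permAction K V σ (PiTensorProduct.tprod K f) =
      PiTensorProduct.tprod K (fun i => f (σ⁻¹ i)) := by
  unfold permAction
  exact PiTensorProduct.reindex_tprod σ f

/-- The representation of the symmetric group on the tensor power. -/
def permHom : Equiv.Perm (Fin d) →* Module.End K (⨂[K] _ : Fin d, V) where
  toFun σ := permAction K V σ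
  map_one' := by
    apply PiTensorProduct.ext
    ext f
    simp [permAction_tprod]
    rfl
  map_mul' σ τ := by
    apply PiTensorProduct.ext
    ext f
    simp [permAction_tprod]
    rfl

/-- The action of the group algebra. -/
def rho : MonoidAlgebra K (Equiv.Perm (Fin d)) →ₐ[K] Module.End K (⨂[K] _ : Fin d, V) :=
  MonoidAlgebra.lift K _ _ (permHom K V)

theorem rho_single (σ : Equiv.Perm (Fin d)) (r : K) :
    rho K V (MonoidAlgebra.single σ r) = r • permAction K V σ :=
  MonoidAlgebra.lift_single _ _ _

theorem rho_youngSym (T : Fin d → ℕ × ℕ) :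
    rho K V (youngSym K T) = youngSymmetrizerAction K V T := by
  unfold youngSym rowSym colSym youngSymmetrizerAction
  rw [map_mul, map_sum, map_sum]
  simp only [rho_single, one_smul]
  rfl

theorem perm_conj_map (σ : Equiv.Perm (Fin d)) (A : Fin d → (V →ₗ[K] V))
    (w : ⨂[K] _ : Fin d, V) :
    permAction K V σ (PiTensorProduct.map A (permAction K V σ⁻¹ w)) =
      PiTensorProduct.map (fun i => A (σ⁻¹ i)) w := by
  have : permAction K V σ ∘ₗ PiTensorProduct.map A ∘ₗ permAction K V σ⁻¹ =
      PiTensorProduct.map (fun i => A (σ⁻¹ i)) := by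
    apply PiTensorProduct.ext
    ext f
    have h : ∀ i, (σ⁻¹).symm (σ.symm i) = i := fun i => σ.apply_symm_apply i
    simp [permAction_tprod]
    congr 1
    funext i
    exact congrArg _ (congrArg f (h i))
  exact LinearMap.congr_fun this w

theorem stable_sym [CharZero K] [FiniteDimensional K V]
    (W : Submodule K (⨂[K] _ : Fin d, V))
    (hW : ∀ g : V ≃ₗ[K] V, ∀ w ∈ W, glAction K V g w ∈ W) (A : Fin d → (V →ₗ[K] V))
    (w : ⨂[K] _ : Fin d, V) (hw : w ∈ W) :
    ∑ σ : Equiv.Perm (Fin d),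
      permAction K V σ (PiTensorProduct.map A (permAction K V σ⁻¹ w)) ∈ W := by
  let F : MultilinearMap K (fun _ : Fin d => (V →ₗ[K] V)) ((⨂[K] _ : Fin d, V) ⧸ W) :=
    (W.mkQ ∘ₗ (LinearMap.applyₗ w)).compMultilinearMap
      (PiTensorProduct.mapMultilinear K (fun _ : Fin d => V) (fun _ : Fin d => V))
  have hFd : ∀ A, F A = W.mkQ (PiTensorProduct.map A w) := fun A => rfl
  have h1 := polarization K F (diag_of_gl K V F (fun g => by
    rw [hFd, Submodule.mkQ_apply, Submodule.Quotient.mk_eq_zero]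
    exact hW g w hw)) A
  simp only [hFd] at h1
  rw [← map_sum, Submodule.mkQ_apply, Submodule.Quotient.mk_eq_zero] at h1
  simp only [perm_conj_map]
  convert h1 using 1
  exact Equiv.sum_comp (Equiv.inv (Equiv.Perm (Fin d)))
    (fun σ => PiTensorProduct.map (fun i => A (σ i)) w)

theorem rank_one_map {κ : Type} (b : Module.Basis κ K V) (p : Fin d → κ) (y : Fin d → V)
    (v : ⨂[K] _ : Fin d, V) :
    PiTensorProduct.map (fun i => LinearMap.smulRight (b.coord (p i)) (y i)) v =
      (Basis.piTensorProduct (fun _ : Fin d => b)).repr v p • PiTensorProduct.tprod K y := by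
  have : PiTensorProduct.map (fun i => LinearMap.smulRight (b.coord (p i)) (y i)) =
      LinearMap.smulRight ((Basis.piTensorProduct (fun _ : Fin d => b)).coord p)
        (PiTensorProduct.tprod K y) := by
    apply PiTensorProduct.ext
    ext f
    simp [Basis.piTensorProduct_repr_tprod_apply, MultilinearMap.map_smul_univ]
  exact LinearMap.congr_fun this v

theorem stable_rank_one [CharZero K] [FiniteDimensional K V] {κ : Type} (b : Module.Basis κ K V)
    (W : Submodule K (⨂[K] _ : Fin d, V))
    (hW : ∀ g : V ≃ₗ[K] V, ∀ w ∈ W, glAction K V g w ∈ W)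
    (w : ⨂[K] _ : Fin d, V) (hw : w ∈ W) (p : Fin d → κ) (y : ⨂[K] _ : Fin d, V) :
    ∑ σ : Equiv.Perm (Fin d),
      (Basis.piTensorProduct (fun _ : Fin d => b)).repr (permAction K V σ⁻¹ w) p •
        permAction K V σ y ∈ W := by
  induction y using PiTensorProduct.induction_on with
  | smul_tprod r y =>
    have h := stable_sym K V W hW (fun i => LinearMap.smulRight (b.coord (p i)) (y i)) w hw
    simp only [rank_one_map, map_smul] at h
    have h2 := W.smul_mem r h
    rw [Finset.smul_sum] at h2
    simp only [map_smul]
    convert h2 using 1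
    apply Finset.sum_congr rfl
    intro σ _
    rw [smul_comm]
  | add x y hx hy =>
    simp only [map_add, smul_add, Finset.sum_add_distrib]
    exact W.add_mem hx hy

theorem irreducible_aux [CharZero K] [FiniteDimensional K V] {T : Fin d → ℕ × ℕ}
    (hinj : Function.Injective T)
    (hlow : ∀ i c, c ≤ (T i).2 → ∃ j, T j = ((T i).1, c))
    (W : Submodule K (⨂[K] _ : Fin d, V)) (hWs : W ≤ schurModule K V T)
    (hW : ∀ g : V ≃ₗ[K] V, ∀ w ∈ W, glAction K V g w ∈ W) :
    W = ⊥ ∨ W = schurModule K V T := by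
  by_cases hbot : W = ⊥
  · exact Or.inl hbot
  right
  apply le_antisymm hWs
  obtain ⟨w, hw, hw0⟩ := Submodule.exists_mem_ne_zero_of_ne_bot hbot
  obtain ⟨n, hn, hcc⟩ := youngSym_sq K hinj hlow
  set c := youngSym K T with hc
  have hcoeff : ∀ σ : Equiv.Perm (Fin d), c * MonoidAlgebra.single σ 1 * c =
      (n * c.coeff σ⁻¹) • c := by
    intro σ
    rw [hc, youngSym_sandwich K hinj hlow, ← hc, hcc]
    simp
  have hcw : rho K V c w = n • w := by
    obtain ⟨m, rfl⟩ := hWs hw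
    rw [← rho_youngSym, ← hc, ← Module.End.mul_apply, ← map_mul, hcc, map_smul,
      LinearMap.smul_apply]
  let b := Module.finBasis K V
  let B := Basis.piTensorProduct (fun _ : Fin d => b)
  obtain ⟨p, hp⟩ : ∃ p, B.repr w p ≠ 0 := by
    by_contra! h
    exact hw0 (B.ext_elem (fun p => by rw [h p]; simp))
  rintro _ ⟨m, rfl⟩
  rw [← rho_youngSym, ← hc]
  have h1 := stable_rank_one K V b W hW w hw p (rho K V c m)
  have h2 : rho K V c (∑ σ : Equiv.Perm (Fin d),
      B.repr (permAction K V σ⁻¹ w) p • permAction K V σ (rho K V c m)) =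
      (n * (n * B.repr w p)) • rho K V c m := by
    rw [map_sum]
    have h3 : ∀ σ : Equiv.Perm (Fin d), rho K V c (B.repr (permAction K V σ⁻¹ w) p •
        permAction K V σ (rho K V c m)) =
        (n * (c.coeff σ⁻¹ * B.repr (permAction K V σ⁻¹ w) p)) • rho K V c m := by
      intro σ
      have h4 : rho K V c (permAction K V σ (rho K V c m)) =
          rho K V (c * MonoidAlgebra.single σ 1 * c) m := by
        rw [map_mul, map_mul, rho_single, one_smul]; rfl
      rw [map_smul, h4, hcoeff, map_smul, LinearMap.smul_apply, smul_smul]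
      congr 1; ring
    rw [Finset.sum_congr rfl (fun σ _ => h3 σ), ← Finset.sum_smul, ← Finset.mul_sum]
    congr 2
    have h5 : rho K V c w = ∑ σ : Equiv.Perm (Fin d), c.coeff σ • permAction K V σ w := by
      unfold rho
      rw [MonoidAlgebra.lift_apply, Finsupp.sum_fintype _ _ (by simp), LinearMap.sum_apply]
      rfl
    have h6 : B.repr (rho K V c w) p = n * B.repr w p := by rw [hcw]; simp
    rw [← h6, h5, map_sum, Finsupp.finsetSum_apply]
    simp only [map_smul, Finsupp.smul_apply, smul_eq_mul]
    exact Equiv.sum_comp (Equiv.inv (Equiv.Perm (Fin d)))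
      (fun σ => c.coeff σ * B.repr (permAction K V σ w) p)
  have h7 : ∀ x ∈ W, rho K V c x ∈ W := by
    intro x hx
    obtain ⟨m, rfl⟩ := hWs hx
    have : rho K V c (youngSymmetrizerAction K V T m) = n • (youngSymmetrizerAction K V T m) := by
      rw [← rho_youngSym, ← hc, ← Module.End.mul_apply, ← map_mul, hcc, map_smul,
        LinearMap.smul_apply]
    rw [this]
    exact W.smul_mem n hx
  have h8 := h7 _ h1
  rw [h2] at h8
  exact (W.smul_mem_iff (mul_ne_zero hn (mul_ne_zero hn hp))).1 h8

theorem schur_zero [CharZero K] [FiniteDimensional K V] {lam : Nat.Partition d}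
    {T : Fin d → ℕ × ℕ} (hT : IsYoungTableau lam T)
    (h : Module.finrank K V < lam.parts.card) : schurModule K V T = ⊥ := by
  unfold schurModule
  rw [LinearMap.range_eq_bot, ← rho_youngSym, youngSym, map_mul]
  have : rho K V (colSym K T) = 0 := by
    let b := Module.finBasis K V
    apply (Basis.piTensorProduct (fun _ : Fin d => b)).ext
    intro f
    rw [Basis.piTensorProduct_apply]
    choose u hu using fun r : Fin lam.parts.card => shape_first_col hT r.1 r.2
    obtain ⟨r, s, hrs, hf⟩ := Fintype.exists_ne_map_eq_of_card_lt (fun r => f (u r)) (by simpa using h)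
    have hne : u r ≠ u s := by
      intro he
      have h1 := hu r
      rw [he, hu s] at h1
      simp only [Prod.mk.injEq] at h1
      exact hrs (Fin.ext h1.1.symm)
    have hq : ∀ i, (T (Equiv.swap (u r) (u s) i)).2 = (T i).2 := by
      intro k
      rw [Equiv.swap_apply_def]; split_ifs with h h
      · rw [h, hu, hu]
      · rw [h, hu, hu]
      · rfl
    have h2 := congrArg (rho K V) (colSym_mul_single K hq)
    rw [map_mul, rho_single, one_smul, Equiv.Perm.sign_swap hne, map_smul] at h2
    have h3 := LinearMap.congr_fun h2 (PiTensorProduct.tprod K (fun i => b (f i)))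
    rw [Module.End.mul_apply, permAction_tprod] at h3
    have h4 : (fun i => b (f ((Equiv.swap (u r) (u s))⁻¹ i))) = fun i => b (f i) := by
      funext i
      rw [Equiv.swap_inv, Equiv.swap_apply_def]; split_ifs with h h
      · rw [h]; exact congrArg b hf.symm
      · rw [h]; exact congrArg b hf
      · rfl
    rw [h4] at h3
    simp only [LinearMap.smul_apply, Units.val_neg, Units.val_one, Int.cast_neg, Int.cast_one,
      neg_smul, one_smul] at h3
    rw [LinearMap.zero_apply]
    have h5 : (2 : K) • rho K V (colSym K T) (PiTensorProduct.tprod K (fun i => b (f i))) = 0 := by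
      rw [two_smul]; nth_rewrite 1 [h3]; simp
    exact (smul_eq_zero.1 h5).resolve_left two_ne_zero
  rw [this, mul_zero]

theorem schur_ne_zero [CharZero K] [FiniteDimensional K V] {lam : Nat.Partition d}
    {T : Fin d → ℕ × ℕ} (hT : IsYoungTableau lam T)
    (h : lam.parts.card ≤ Module.finrank K V) : schurModule K V T ≠ ⊥ := by
  intro hbot
  unfold schurModule at hbot
  rw [LinearMap.range_eq_bot] at hbot
  let b := Module.finBasis K V
  let B := Basis.piTensorProduct (fun _ : Fin d => b)
  let f : Fin d → Fin (Module.finrank K V) := fun i =>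
    ⟨(T i).1, lt_of_lt_of_le (shape_row_lt hT i) h⟩
  have hff : ∀ i j, f i = f j ↔ (T i).1 = (T j).1 := by
    intro i j; simp [f]
  have hB : ∀ g : Equiv.Perm (Fin d), B.repr (permAction K V g (B f)) f =
      if (∀ i, (T (g i)).1 = (T i).1) then 1 else 0 := by
    intro g
    rw [Basis.piTensorProduct_apply, permAction_tprod,
      Basis.piTensorProduct_repr_tprod_apply]
    simp only [Module.Basis.repr_self, Finsupp.single_apply, hff]
    rw [Finset.prod_ite_zero, Finset.prod_const_one]
    have hiff : (∀ i ∈ Finset.univ, (T (g⁻¹ i)).1 = (T i).1) ↔ ∀ i, (T (g i)).1 = (T i).1 := by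
      constructor
      · intro h i
        have := row_inv (p := g⁻¹) (fun i => h i (Finset.mem_univ i)) i
        simpa using this
      · intro h i _; exact row_inv h i
    by_cases hc : ∀ i, (T (g i)).1 = (T i).1
    · rw [if_pos hc, if_pos (hiff.2 hc)]
    · rw [if_neg hc, if_neg (fun h => hc (hiff.1 h))]
  have hz : B.repr (youngSymmetrizerAction K V T (B f)) f = 0 := by rw [hbot]; simp
  unfold youngSymmetrizerAction at hz
  rw [LinearMap.comp_apply, LinearMap.sum_apply _ _ (B f), map_sum] at hz
  simp only [LinearMap.smul_apply, map_smul, LinearMap.sum_apply] at hz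
  have hmul : ∀ σ τ : Equiv.Perm (Fin d), permAction K V σ (permAction K V τ (B f)) =
      permAction K V (σ * τ) (B f) := by
    intro σ τ
    exact (LinearMap.congr_fun (map_mul (permHom K V) σ τ) (B f)).symm
  simp only [hmul, map_sum, map_smul, Finsupp.finsetSum_apply, Finsupp.smul_apply, hB] at hz
  rw [Finset.sum_eq_single 1] at hz
  · rw [Finset.sum_congr rfl (g := fun _ => (1 : K))] at hz
    · simp only [Equiv.Perm.sign_one, Units.val_one, Int.cast_one, one_smul,
        Finset.sum_const, nsmul_eq_mul, mul_one, Nat.cast_eq_zero, Finset.card_eq_zero] at hz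
      have : (1 : Equiv.Perm (Fin d)) ∈ Finset.univ.filter
        (fun σ : Equiv.Perm (Fin d) => ∀ i, (T (σ i)).1 = (T i).1) := by simp
      rw [hz] at this
      simp at this
    · intro σ hσ
      rw [mul_one, if_pos (by simpa using hσ)]
  · intro τ hτ hne
    rw [Finset.sum_eq_zero, smul_zero]
    intro σ hσ
    rw [if_neg]
    intro hst
    simp only [Finset.mem_filter, Finset.mem_univ, true_and] at hσ hτ
    apply hne
    refine perm_eq_one_of_row_col hT.1 (fun i => ?_) hτ
    rw [← hσ (τ i)]; exact hst i
  · intro h; simp at h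

end representation

theorem schur_functor_zero_iff_and_irreducible
    [CharZero K] [FiniteDimensional K V]
    (d : ℕ) (lam : Nat.Partition d) (T : Fin d → ℕ × ℕ)
    (hT : IsYoungTableau lam T) :
    (schurModule K V T = ⊥ ↔ Module.finrank K V < lam.parts.card) ∧
    (lam.parts.card ≤ Module.finrank K V →
      schurModule K V T ≠ ⊥ ∧
      -- irreducibility as a GL(V)-representation
      ∀ W : Submodule K (⨂[K] _ : Fin d, V), W ≤ schurModule K V T →
        (∀ g : V ≃ₗ[K] V, ∀ w ∈ W, glAction K V g w ∈ W) →
        W = ⊥ ∨ W = schurModule K V T) := by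
  have hlow := shape_lower hT
  refine ⟨⟨fun h => ?_, schur_zero K V hT⟩, fun h => ⟨schur_ne_zero K V hT h, ?_⟩⟩
  · by_contra hlt
    exact schur_ne_zero K V hT (not_lt.1 hlt) h
  · intro W hWs hW
    exact irreducible_aux K V hT.1 hlow W hWs hW

end
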